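/- Let n be a positive integer. For (k, j, k', j') ∈ ℤ_n⁴, let σ(k,j,k',j') be the linear operator on the space M_n of n×n complex matrices given by σ(k,j,k',j')(a) = Λ^k Sh^j a (Sh^{j'})* Λ^{−k'}. Then for every linear operator T on M_n, the average (1/n⁴) Σ_{(k,j,k',j') ∈ ℤ_n⁴} σ(k,j,k',j') ∘ T ∘ σ(k,j,k',j')* = (tr(T)/n²) · Id, where tr(T) is the trace of T as a linear operator on M_n, σ(k,j,k',j')* is its adjoint with respect to the Hilbert–Schmidt inner product ⟨a,b⟩ = tr(a* b) on M_n, and Id is the identity operator on M_n. -/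

import Mathlib

open scoped BigOperators Matrix

/-- The modulation matrix `Λ` with `Λ e_l = e^{2πi l / n} e_l`. -/
noncomputable def modMatrix (n : ℕ) : Matrix (Fin n) (Fin n) ℂ :=
  Matrix.diagonal fun l => Complex.exp (2 * Real.pi * Complex.I * l / n)

/-- The circular shift matrix `Sh` with `Sh e_l = e_{l+1}` (indices mod `n`). -/
def shiftMatrix (n : ℕ) [NeZero n] : Matrix (Fin n) (Fin n) ℂ :=
  fun i j => if i = j + 1 then 1 else 0

/-- The representation `σ(k,j,k',j')(a) = Λ^k Sh^j a (Sh^{j'})* Λ^{-k'}` on `M_n`. -/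
noncomputable def sigmaMap (n : ℕ) [NeZero n]
    (g : ZMod n × ZMod n × ZMod n × ZMod n) :
    Matrix (Fin n) (Fin n) ℂ →ₗ[ℂ] Matrix (Fin n) (Fin n) ℂ where
  toFun a := modMatrix n ^ g.1.val * shiftMatrix n ^ g.2.1.val * a *
      (shiftMatrix n ^ g.2.2.2.val)ᴴ * (modMatrix n ^ g.2.2.1.val)⁻¹
  map_add' a b := by simp [Matrix.mul_add, Matrix.add_mul]
  map_smul' c a := by simp [Matrix.mul_smul, Matrix.smul_mul]

theorem shiftMatrix_pow_apply (n : ℕ) [NeZero n] (m : ℕ) (r s : Fin n) :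
    (shiftMatrix n ^ m) r s = if r = s + Fin.ofNat n m then 1 else 0 := by
  induction m generalizing r with
  | zero =>
    simp [Matrix.one_apply]
  | succ m ih =>
    have h : Fin.ofNat n (m + 1) = Fin.ofNat n m + 1 := by
      ext; simp [Fin.val_add]
    rw [pow_succ', Matrix.mul_apply, h, Finset.sum_eq_single (s + Fin.ofNat n m)]
    · rw [ih, if_pos rfl, mul_one, ← add_assoc]
      rfl
    · intro b _ hb
      rw [ih, if_neg hb, mul_zero]
    · simp

theorem modMatrix_pow (n m : ℕ) :
    modMatrix n ^ m = Matrix.diagonal fun l : Fin n =>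
      (Complex.exp (2 * Real.pi * Complex.I / n) ^ (l : ℕ)) ^ m := by
  rw [modMatrix, Matrix.diagonal_pow]
  congr 1
  ext l
  rw [Pi.pow_apply, ← Complex.exp_nat_mul _ (l : ℕ)]
  congr 2
  ring

theorem sigmaMap_apply (n : ℕ) [NeZero n] (g : ZMod n × ZMod n × ZMod n × ZMod n)
    (a : Matrix (Fin n) (Fin n) ℂ) (r t : Fin n) :
    sigmaMap n g a r t =
      (Complex.exp (2 * Real.pi * Complex.I / n) ^ (r : ℕ)) ^ g.1.val *
        a (r - Fin.ofNat n g.2.1.val) (t - Fin.ofNat n g.2.2.2.val) *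
        ((Complex.exp (2 * Real.pi * Complex.I / n) ^ (t : ℕ)) ^ g.2.2.1.val)⁻¹ := by
  have hinv : (modMatrix n ^ g.2.2.1.val)⁻¹ = Matrix.diagonal fun l : Fin n =>
      ((Complex.exp (2 * Real.pi * Complex.I / n) ^ (l : ℕ)) ^ g.2.2.1.val)⁻¹ := by
    apply Matrix.inv_eq_right_inv
    rw [modMatrix_pow, Matrix.diagonal_mul_diagonal, ← Matrix.diagonal_one]
    congr 1
    ext l
    exact mul_inv_cancel₀ (pow_ne_zero _ (pow_ne_zero _ (Complex.exp_ne_zero _)))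
  change (modMatrix n ^ g.1.val * shiftMatrix n ^ g.2.1.val * a *
      (shiftMatrix n ^ g.2.2.2.val)ᴴ * (modMatrix n ^ g.2.2.1.val)⁻¹) r t = _
  rw [hinv, Matrix.mul_diagonal, modMatrix_pow, Matrix.mul_assoc, Matrix.mul_assoc,
    Matrix.diagonal_mul]
  congr 2
  rw [Matrix.mul_apply, Finset.sum_eq_single (r - Fin.ofNat n g.2.1.val)]
  · rw [shiftMatrix_pow_apply, if_pos (by simp), one_mul, Matrix.mul_apply,
      Finset.sum_eq_single (t - Fin.ofNat n g.2.2.2.val)]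
    · rw [Matrix.conjTranspose_apply, shiftMatrix_pow_apply, if_pos (by simp), star_one, mul_one]
    · intro b _ hb
      rw [Matrix.conjTranspose_apply, shiftMatrix_pow_apply,
        if_neg (fun h => hb (eq_sub_of_add_eq h.symm)), star_zero, mul_zero]
    · simp
  · intro b _ hb
    rw [shiftMatrix_pow_apply, if_neg (fun h => hb (eq_sub_of_add_eq h.symm)), zero_mul]
  · simp

theorem star_rootOfUnity_pow (n l k : ℕ) :
    star ((Complex.exp (2 * Real.pi * Complex.I / n) ^ l) ^ k) =
      ((Complex.exp (2 * Real.pi * Complex.I / n) ^ l) ^ k)⁻¹ := by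
  have h : star (Complex.exp (2 * Real.pi * Complex.I / n)) =
      (Complex.exp (2 * Real.pi * Complex.I / n))⁻¹ := by
    rw [← Complex.exp_neg, Complex.star_def, ← Complex.exp_conj]
    congr 1
    simp [neg_div, Complex.conj_ofNat]
  rw [star_pow, star_pow, h, inv_pow, inv_pow]

theorem sigmaMap_single (n : ℕ) [NeZero n] (g : ZMod n × ZMod n × ZMod n × ZMod n)
    (p q : Fin n) :
    sigmaMap n g (Matrix.single (p - Fin.ofNat n g.2.1.val) (q - Fin.ofNat n g.2.2.2.val) 1) =
      Matrix.single p q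
        ((Complex.exp (2 * Real.pi * Complex.I / n) ^ (p : ℕ)) ^ g.1.val *
          ((Complex.exp (2 * Real.pi * Complex.I / n) ^ (q : ℕ)) ^ g.2.2.1.val)⁻¹) := by
  ext r t
  rw [sigmaMap_apply, Matrix.single_apply, Matrix.single_apply]
  simp only [sub_left_inj]
  split_ifs with h
  · rw [h.1, h.2, mul_one]
  · simp

theorem adjoint_sigmaMap_single (n : ℕ) [NeZero n] (g : ZMod n × ZMod n × ZMod n × ZMod n)
    (S : Matrix (Fin n) (Fin n) ℂ →ₗ[ℂ] Matrix (Fin n) (Fin n) ℂ)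
    (hS : ∀ a b, ((S a)ᴴ * b).trace = (aᴴ * (sigmaMap n g b)).trace) (p q : Fin n) :
    S (Matrix.single p q 1) =
      (((Complex.exp (2 * Real.pi * Complex.I / n) ^ (p : ℕ)) ^ g.1.val)⁻¹ *
          (Complex.exp (2 * Real.pi * Complex.I / n) ^ (q : ℕ)) ^ g.2.2.1.val) •
        Matrix.single (p - Fin.ofNat n g.2.1.val) (q - Fin.ofNat n g.2.2.2.val) 1 := by
  ext r t
  obtain ⟨r, rfl⟩ : ∃ r', r = r' - Fin.ofNat n g.2.1.val := ⟨r + Fin.ofNat n g.2.1.val, by simp⟩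
  obtain ⟨t, rfl⟩ : ∃ t', t = t' - Fin.ofNat n g.2.2.2.val :=
    ⟨t + Fin.ofNat n g.2.2.2.val, by simp⟩
  have h := hS (Matrix.single p q 1)
    (Matrix.single (r - Fin.ofNat n g.2.1.val) (t - Fin.ofNat n g.2.2.2.val) 1)
  rw [sigmaMap_single, Matrix.trace_mul_single, Matrix.trace_mul_single] at h
  have h' := congrArg star h
  simp only [Matrix.conjTranspose_apply, MulOpposite.op_one, one_smul, star_star,
    MulOpposite.smul_eq_mul_unop, MulOpposite.unop_op, star_mul', star_inv₀,
    star_rootOfUnity_pow, inv_inv] at h'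
  rw [h', Matrix.smul_apply, Matrix.single_apply, Matrix.single_apply]
  simp only [sub_left_inj]
  split_ifs with h
  · rw [h.1, h.2]; simp
  · simp

theorem sum_rootOfUnity_pow (n : ℕ) [NeZero n] (r p : Fin n) :
    ∑ k : ZMod n, (Complex.exp (2 * Real.pi * Complex.I / n) ^ (r : ℕ)) ^ k.val *
      ((Complex.exp (2 * Real.pi * Complex.I / n) ^ (p : ℕ)) ^ k.val)⁻¹ =
      if r = p then (n : ℂ) else 0 := by
  have hζ := Complex.isPrimitiveRoot_exp n (NeZero.ne n)
  set ζ := Complex.exp (2 * Real.pi * Complex.I / n)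
  have h0 : ζ ≠ 0 := hζ.ne_zero (NeZero.ne n)
  have hsum : ∀ f : ℕ → ℂ, ∑ k : ZMod n, f k.val = ∑ k ∈ Finset.range n, f k := by
    intro f
    obtain ⟨m, rfl⟩ := Nat.exists_eq_succ_of_ne_zero (NeZero.ne n)
    exact Fin.sum_univ_eq_sum_range f (m + 1)
  rw [hsum fun k => (ζ ^ (r : ℕ)) ^ k * ((ζ ^ (p : ℕ)) ^ k)⁻¹]
  simp only [← div_eq_mul_inv, ← div_pow]
  split_ifs with h
  · subst h
    simp [div_self (pow_ne_zero _ h0)]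
  · have hne : ζ ^ (r : ℕ) / ζ ^ (p : ℕ) ≠ 1 := by
      intro h1
      rw [div_eq_one_iff_eq (pow_ne_zero _ h0)] at h1
      exact h (Fin.ext (hζ.pow_inj r.2 p.2 h1))
    rw [geom_sum_eq hne, div_pow, ← pow_mul, ← pow_mul, mul_comm _ n, mul_comm _ n, pow_mul,
      pow_mul, hζ.pow_eq_one]
    simp

theorem sum_sub_ofNat_val (n : ℕ) [NeZero n] (p : Fin n) (f : Fin n → ℂ) :
    ∑ j : ZMod n, f (p - Fin.ofNat n j.val) = ∑ i, f i := by
  rw [← Equiv.sum_comp (Equiv.subLeft p) f]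
  obtain ⟨m, rfl⟩ := Nat.exists_eq_succ_of_ne_zero (NeZero.ne n)
  refine Finset.sum_congr rfl fun j _ => ?_
  congr 2
  exact Fin.ofNat_val_eq_self (n := m + 1) j

theorem trace_eq_sum_single (n : ℕ)
    (T : Matrix (Fin n) (Fin n) ℂ →ₗ[ℂ] Matrix (Fin n) (Fin n) ℂ) :
    LinearMap.trace ℂ (Matrix (Fin n) (Fin n) ℂ) T =
      ∑ p, ∑ q, T (Matrix.single p q 1) p q := by
  rw [LinearMap.trace_eq_matrix_trace ℂ (Matrix.stdBasis ℂ (Fin n) (Fin n)), Matrix.trace,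
    Fintype.sum_prod_type]
  refine Finset.sum_congr rfl fun p _ => Finset.sum_congr rfl fun q _ => ?_
  rw [Matrix.diag_apply, LinearMap.toMatrix_apply, Matrix.stdBasis_eq_single]
  rfl

/-- Isotropy of the double quantum Fourier transform representation: for every linear
operator `T` on `M_n`, averaging `σ(g) ∘ T ∘ σ(g)*` over the group `ℤ_n⁴` yields
`(tr T / n²) · Id`.  Here `σ(g)*` denotes the adjoint of `σ(g)` with respect to the
Hilbert–Schmidt inner product `⟨a, b⟩ = tr(aᴴ b)`, characterized by the hypothesis
`hσstar`. -/
theorem sigma_isotropic (n : ℕ) [NeZero n]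
    (σstar : ZMod n × ZMod n × ZMod n × ZMod n →
      Matrix (Fin n) (Fin n) ℂ →ₗ[ℂ] Matrix (Fin n) (Fin n) ℂ)
    (hσstar : ∀ g a b, ((σstar g a)ᴴ * b).trace = (aᴴ * (sigmaMap n g b)).trace)
    (T : Matrix (Fin n) (Fin n) ℂ →ₗ[ℂ] Matrix (Fin n) (Fin n) ℂ) :
    (((n : ℂ) ^ 4)⁻¹) •
        ∑ g : ZMod n × ZMod n × ZMod n × ZMod n,
          (sigmaMap n g) ∘ₗ T ∘ₗ (σstar g) =
      ((LinearMap.trace ℂ (Matrix (Fin n) (Fin n) ℂ) T) / (n : ℂ) ^ 2) • LinearMap.id := by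
  have hn : (n : ℂ) ≠ 0 := Nat.cast_ne_zero.mpr (NeZero.ne n)
  refine (Matrix.stdBasis ℂ (Fin n) (Fin n)).ext fun ⟨p, q⟩ => ?_
  rw [Matrix.stdBasis_eq_single]
  ext r t
  set ζ := Complex.exp (2 * Real.pi * Complex.I / n)
  have hterm : ∀ g : ZMod n × ZMod n × ZMod n × ZMod n,
      (sigmaMap n g ∘ₗ T ∘ₗ σstar g) (Matrix.single p q 1) r t =
        ((ζ ^ (r : ℕ)) ^ g.1.val * ((ζ ^ (p : ℕ)) ^ g.1.val)⁻¹) *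
        (((ζ ^ (q : ℕ)) ^ g.2.2.1.val * ((ζ ^ (t : ℕ)) ^ g.2.2.1.val)⁻¹) *
        T (Matrix.single (p - Fin.ofNat n g.2.1.val) (q - Fin.ofNat n g.2.2.2.val) 1)
          (r - Fin.ofNat n g.2.1.val) (t - Fin.ofNat n g.2.2.2.val)) := by
    intro g
    rw [LinearMap.comp_apply, LinearMap.comp_apply,
      adjoint_sigmaMap_single n g _ (hσstar g), map_smul, map_smul, Matrix.smul_apply,
      sigmaMap_apply, smul_eq_mul]
    ring
  have hsum : ∑ g : ZMod n × ZMod n × ZMod n × ZMod n,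
      (sigmaMap n g ∘ₗ T ∘ₗ σstar g) (Matrix.single p q 1) r t =
      (if r = p then (n : ℂ) else 0) * ((if q = t then (n : ℂ) else 0) *
        ∑ j : ZMod n, ∑ j' : ZMod n,
          T (Matrix.single (p - Fin.ofNat n j.val) (q - Fin.ofNat n j'.val) 1)
            (r - Fin.ofNat n j.val) (t - Fin.ofNat n j'.val)) := by
    simp only [hterm, Fintype.sum_prod_type]
    simp only [← Finset.mul_sum]
    rw [← Finset.sum_mul, sum_rootOfUnity_pow]
    congr 1
    simp only [← Finset.sum_mul, ← Finset.mul_sum]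
    rw [sum_rootOfUnity_pow]
  rw [LinearMap.smul_apply, LinearMap.smul_apply, LinearMap.sum_apply, Matrix.smul_apply,
    Matrix.smul_apply, Matrix.sum_apply, hsum, LinearMap.id_apply, Matrix.single_apply,
    smul_eq_mul, smul_eq_mul]
  by_cases h : p = r ∧ q = t
  · obtain ⟨rfl, rfl⟩ := h
    have htr : ∑ j : ZMod n, ∑ j' : ZMod n,
        T (Matrix.single (p - Fin.ofNat n j.val) (q - Fin.ofNat n j'.val) 1)
          (p - Fin.ofNat n j.val) (q - Fin.ofNat n j'.val) =
        LinearMap.trace ℂ (Matrix (Fin n) (Fin n) ℂ) T := by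
      rw [trace_eq_sum_single,
        ← sum_sub_ofNat_val n p fun i => ∑ i', T (Matrix.single i i' 1) i i']
      refine Finset.sum_congr rfl fun j _ => ?_
      exact sum_sub_ofNat_val n q fun i' => T (Matrix.single _ i' 1) _ i'
    rw [htr]
    simp only [if_true, and_self]
    field_simp
  · rw [if_neg h]
    rcases not_and_or.mp h with h | h
    · simp [Ne.symm h]
    · simp [h]
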